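/- Let d be a positive integer, let D, Q : ℝ^d → Mat(d×d, ℝ) be twice continuously differentiable matrix-valued functions with Q(y) skew-symmetric for every y and D(y) positive semi-definite for every y, and let H : ℝ^d → ℝ be twice continuously differentiable. Define Γ_i(y) = Σ_{j=1}^d ∂/∂y_j ( D_{ij}(y) + Q_{ij}(y) ) and f_i(y) = −Σ_{j=1}^d ( D_{ij}(y) + Q_{ij}(y) ) ∂H/∂y_j (y) + Γ_i(y). Let Z > 0 be a constant and set q(y) = exp(−H(y))/Z. Then (i) q(y) ∂H/∂y_j(y) + ∂q/∂y_j(y) = 0 for every j and every y, and (ii) the Fokker–Planck right-hand side vanishes identically: −Σ_{i=1}^d ∂/∂y_i [ f_i(y) q(y) ] + Σ_{i=1}^d Σ_{j=1}^d ∂²/∂y_i∂y_j [ D_{ij}(y) q(y) ] = 0 for every y ∈ ℝ^d. In other words, exp(−H)/Z is a stationary solution of the Fokker–Planck equation associated to drift f and diffusion matrix D. -/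

import Mathlib

open Matrix

/-- Partial derivative of a real-valued function on `ℝ^d` in the `i`-th coordinate
direction. -/
noncomputable def pderiv' {d : ℕ} (i : Fin d) (f : (Fin d → ℝ) → ℝ) (y : Fin d → ℝ) : ℝ :=
  fderiv ℝ f y (Pi.single i 1)

theorem pderiv'_add {d : ℕ} (i : Fin d) {f g : (Fin d → ℝ) → ℝ} {y : Fin d → ℝ}
    (hf : DifferentiableAt ℝ f y) (hg : DifferentiableAt ℝ g y) :
    pderiv' i (fun z => f z + g z) y = pderiv' i f y + pderiv' i g y := by
  simp [pderiv', fderiv_fun_add hf hg]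

theorem pderiv'_neg {d : ℕ} (i : Fin d) (f : (Fin d → ℝ) → ℝ) (y : Fin d → ℝ) :
    pderiv' i (fun z => -f z) y = -pderiv' i f y := by
  simp [pderiv', fderiv_fun_neg]

theorem pderiv'_mul {d : ℕ} (i : Fin d) {f g : (Fin d → ℝ) → ℝ} {y : Fin d → ℝ}
    (hf : DifferentiableAt ℝ f y) (hg : DifferentiableAt ℝ g y) :
    pderiv' i (fun z => f z * g z) y = f y * pderiv' i g y + g y * pderiv' i f y := by
  simp [pderiv', fderiv_fun_mul hf hg]

theorem pderiv'_sum {d : ℕ} {ι : Type*} (s : Finset ι) (i : Fin d)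
    {f : ι → (Fin d → ℝ) → ℝ} {y : Fin d → ℝ} (hf : ∀ k ∈ s, DifferentiableAt ℝ (f k) y) :
    pderiv' i (fun z => ∑ k ∈ s, f k z) y = ∑ k ∈ s, pderiv' i (f k) y := by
  simp [pderiv', fderiv_fun_sum hf]

theorem ContDiff.differentiable_pderiv' {d : ℕ} {f : (Fin d → ℝ) → ℝ} (hf : ContDiff ℝ 2 f)
    (i : Fin d) : Differentiable ℝ (pderiv' i f) :=
  ((hf.fderiv_right (m := 1) (by norm_num)).differentiable (by norm_num)).clm_apply
    (differentiable_const _)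

/-- Mixed second partial derivatives of a `C²` function commute. -/
theorem ContDiff.pderiv'_comm {d : ℕ} {f : (Fin d → ℝ) → ℝ} (hf : ContDiff ℝ 2 f)
    (i j : Fin d) (y : Fin d → ℝ) :
    pderiv' i (pderiv' j f) y = pderiv' j (pderiv' i f) y := by
  have hd : DifferentiableAt ℝ (fderiv ℝ f) y :=
    (hf.fderiv_right (m := 1) (by norm_num)).differentiable (by norm_num) y
  have key (k l : Fin d) : pderiv' k (pderiv' l f) y =
      fderiv ℝ (fderiv ℝ f) y (Pi.single k 1) (Pi.single l 1) := by
    change fderiv ℝ (fun z => fderiv ℝ f z (Pi.single l 1)) y (Pi.single k 1) = _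
    rw [fderiv_clm_apply hd (differentiableAt_const _)]
    simp
  rw [key, key]
  exact hf.contDiffAt.isSymmSndFDerivAt (by simp) _ _

/-- The double divergence of a skew-symmetric `C²` matrix field vanishes. -/
theorem sum_pderiv'_pderiv'_eq_zero_of_skew {d : ℕ} {A : Fin d → Fin d → (Fin d → ℝ) → ℝ}
    (hA : ∀ i j, ContDiff ℝ 2 (A i j)) (hskew : ∀ i j y, A j i y = -A i j y)
    (y : Fin d → ℝ) : ∑ i, ∑ j, pderiv' i (pderiv' j (A i j)) y = 0 := by
  have anti (i j : Fin d) :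
      pderiv' j (pderiv' i (A j i)) y = -pderiv' i (pderiv' j (A i j)) y := by
    have h : pderiv' i (A j i) = fun z => -pderiv' i (A i j) z := by
      funext z
      rw [← pderiv'_neg, funext (hskew i j)]
    rw [h, pderiv'_neg, (hA i j).pderiv'_comm]
  have h : ∑ i, ∑ j, pderiv' i (pderiv' j (A i j)) y =
      -∑ i, ∑ j, pderiv' i (pderiv' j (A i j)) y := by
    rw [← Finset.sum_neg_distrib, Finset.sum_comm]
    refine Finset.sum_congr rfl fun i _ => ?_
    rw [← Finset.sum_neg_distrib]
    exact Finset.sum_congr rfl fun j _ => anti i j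
  linarith

/-- For the drift `f = −[D+Q]∇H + Γ` and diffusion matrix `D`, with `Q(y)` skew-symmetric
and `D(y)` positive semi-definite for every `y`, the density `q = exp(−H)/Z` satisfies
(i) `q ∂H/∂y_j + ∂q/∂y_j = 0` and (ii) the Fokker–Planck right-hand side vanishes, i.e.
`exp(−H)/Z` is a stationary solution of the Fokker–Planck equation. -/
theorem expNegH_stationary_fokkerPlanck
    (d : ℕ) (hd : 0 < d)
    (D Q : (Fin d → ℝ) → Matrix (Fin d) (Fin d) ℝ)
    (hD : ∀ i j : Fin d, ContDiff ℝ 2 (fun y => D y i j))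
    (hQ : ∀ i j : Fin d, ContDiff ℝ 2 (fun y => Q y i j))
    (hskew : ∀ y : Fin d → ℝ, (Q y)ᵀ = -Q y)
    (hpsd : ∀ y : Fin d → ℝ, (D y).PosSemidef)
    (H : (Fin d → ℝ) → ℝ) (hH : ContDiff ℝ 2 H)
    (Γ : Fin d → (Fin d → ℝ) → ℝ)
    (hΓ : ∀ i y, Γ i y = ∑ j : Fin d, pderiv' j (fun w => D w i j + Q w i j) y)
    (f : Fin d → (Fin d → ℝ) → ℝ)
    (hf : ∀ i y, f i y = -∑ j : Fin d, (D y i j + Q y i j) * pderiv' j H y + Γ i y)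
    (Z : ℝ) (hZ : 0 < Z)
    (q : (Fin d → ℝ) → ℝ) (hq : ∀ y, q y = Real.exp (-H y) / Z) :
    (∀ (j : Fin d) (y : Fin d → ℝ), q y * pderiv' j H y + pderiv' j q y = 0) ∧
    (∀ y : Fin d → ℝ,
      (-∑ i : Fin d, pderiv' i (fun z => f i z * q z) y) +
        ∑ i : Fin d, ∑ j : Fin d,
          pderiv' i (fun z => pderiv' j (fun w => D w i j * q w) z) y = 0) := by
  have hqeq : q = fun y => Real.exp (-H y) / Z := funext hq
  have hq2 : ContDiff ℝ 2 q := hqeq ▸ hH.neg.exp.div_const Z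
  have hgrad (j : Fin d) (y : Fin d → ℝ) : pderiv' j q y = -(q y * pderiv' j H y) := by
    have hder := (hH.differentiable (by norm_num) y).hasFDerivAt.fun_neg.exp.mul_const Z⁻¹
    rw [pderiv', hqeq]
    simp only [div_eq_mul_inv]
    rw [hder.fderiv, pderiv']
    simp
    ring
  refine ⟨fun j y => by rw [hgrad]; ring, fun y => ?_⟩
  have hDq (i j : Fin d) : ContDiff ℝ 2 (fun w => D w i j * q w) := (hD i j).mul hq2
  have hQq (i j : Fin d) : ContDiff ℝ 2 (fun w => Q w i j * q w) := (hQ i j).mul hq2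
  have hflux (i : Fin d) : (fun z => f i z * q z) = fun z => ∑ j : Fin d,
      (pderiv' j (fun w => D w i j * q w) z + pderiv' j (fun w => Q w i j * q w) z) := by
    funext z
    rw [hf, hΓ, ← Finset.sum_neg_distrib, ← Finset.sum_add_distrib, Finset.sum_mul]
    refine Finset.sum_congr rfl fun j _ => ?_
    have hDz := (hD i j).differentiable (by norm_num) z
    have hQz := (hQ i j).differentiable (by norm_num) z
    have hqz := hq2.differentiable (by norm_num) z
    rw [pderiv'_mul j hDz hqz, pderiv'_mul j hQz hqz, pderiv'_add j hDz hQz, hgrad]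
    ring
  have hdiv (i : Fin d) : pderiv' i (fun z => f i z * q z) y =
      ∑ j : Fin d, pderiv' i (pderiv' j (fun w => D w i j * q w)) y +
        ∑ j : Fin d, pderiv' i (pderiv' j (fun w => Q w i j * q w)) y := by
    have hDdiff (j : Fin d) := (hDq i j).differentiable_pderiv' j y
    have hQdiff (j : Fin d) := (hQq i j).differentiable_pderiv' j y
    rw [hflux, pderiv'_sum _ _ fun j _ => (hDdiff j).fun_add (hQdiff j), ← Finset.sum_add_distrib]
    exact Finset.sum_congr rfl fun j _ => pderiv'_add i (hDdiff j) (hQdiff j)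
  have hzero := sum_pderiv'_pderiv'_eq_zero_of_skew hQq (fun i j z => by
    have h := congrFun (congrFun (hskew z) i) j
    simp only [Matrix.transpose_apply, Matrix.neg_apply] at h
    rw [h, neg_mul]) y
  simp only [hdiv, Finset.sum_add_distrib, hzero]
  ring
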